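/- Let π be a group and Λ = ℤ[π] its integral group ring. If f and g are Λ-linear endomorphisms of the free left Λ-module Λⁿ = (Fin n → Λ) such that g ∘ f is the identity, then f ∘ g is the identity; in particular f and g are both Λ-linear automorphisms of Λⁿ. -/

import Mathlib

/-- A positive, faithful trace on a real `*`-algebra, with respect to which left multiplications
are bounded. -/
structure IsBoundedFaithfulTrace {A : Type*} [Ring A] [StarRing A] [Algebra ℝ A]
    (τ : A →ₗ[ℝ] ℝ) : Prop where
  map_mul_comm (x y : A) : τ (x * y) = τ (y * x)
  map_star (x : A) : τ (star x) = τ x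
  map_star_mul_self_nonneg (x : A) : 0 ≤ τ (star x * x)
  eq_zero_of_map_star_mul_self (x : A) : τ (star x * x) = 0 → x = 0
  exists_bound (a : A) : ∃ C : ℝ, ∀ x, τ (star (a * x) * (a * x)) ≤ C * τ (star x * x)

namespace IsBoundedFaithfulTrace

variable {A : Type*} [Ring A] [StarRing A] [Algebra ℝ A] {τ : A →ₗ[ℝ] ℝ}

theorem exists_pos_smul_bound (hτ : IsBoundedFaithfulTrace τ) (a : A) :
    ∃ ε : ℝ, 0 < ε ∧ ∀ x, ε * τ (star (a * x) * (a * x)) ≤ τ (star x * x) := by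
  obtain ⟨C, hC⟩ := hτ.exists_bound a
  refine ⟨(|C| + 1)⁻¹, by positivity, fun x ↦ ?_⟩
  rw [inv_mul_le_iff₀ (by positivity)]
  nlinarith [hC x, hτ.map_star_mul_self_nonneg x, le_abs_self C]

theorem exists_bound_add (hτ : ∀ x, 0 ≤ τ (star x * x)) {a b : A}
    (ha : ∃ C : ℝ, ∀ x, τ (star (a * x) * (a * x)) ≤ C * τ (star x * x))
    (hb : ∃ C : ℝ, ∀ x, τ (star (b * x) * (b * x)) ≤ C * τ (star x * x)) :
    ∃ C : ℝ, ∀ x, τ (star ((a + b) * x) * ((a + b) * x)) ≤ C * τ (star x * x) := by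
  obtain ⟨C, hC⟩ := ha
  obtain ⟨D, hD⟩ := hb
  refine ⟨2 * C + 2 * D, fun x ↦ ?_⟩
  have h := hτ (a * x - b * x)
  have hx := hC x
  have hy := hD x
  simp only [star_add, star_sub, add_mul, mul_add, sub_mul, mul_sub, map_add, map_sub] at h ⊢
  linarith

variable [StarModule ℝ A]

/-- If `r = 1 - ε e e*` with `ε` small, then `τ (r ^ (2 * k))` decreases by at least
`ε ‖e* r ^ k‖²` at each step. -/
theorem le_map_pow_sub_map_pow {e : A} {ε : ℝ} (hε : 0 < ε)
    (hb : ∀ x, ε * τ (star (e * x) * (e * x)) ≤ τ (star x * x)) (k : ℕ) :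
    ε * τ (star (star e * (1 - ε • (e * star e)) ^ k) * (star e * (1 - ε • (e * star e)) ^ k)) ≤
      τ ((1 - ε • (e * star e)) ^ (2 * k)) - τ ((1 - ε • (e * star e)) ^ (2 * (k + 1))) := by
  set r : A := 1 - ε • (e * star e) with hr
  have hsr : star (r ^ k) = r ^ k := by simp [hr]
  have key : r ^ (2 * k) - r ^ (2 * (k + 1)) =
      (2 * ε) • (star (star e * r ^ k) * (star e * r ^ k)) -
        (ε * ε) • (star (e * (star e * r ^ k)) * (e * (star e * r ^ k))) := by
    have h1 : r ^ (2 * k) = r ^ k * r ^ k := by rw [two_mul, pow_add]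
    have h2 : r ^ (2 * (k + 1)) = r ^ k * (r * r) * r ^ k := by
      rw [← pow_two, ← pow_add, ← pow_add]; congr 1; ring
    have h3 : r * r = 1 - (2 * ε) • (e * star e) + (ε * ε) • (e * star e * (e * star e)) := by
      simp only [hr, sub_mul, mul_sub, one_mul, mul_one, smul_mul_assoc, mul_smul_comm]
      module
    rw [h1, h2, h3]
    simp only [star_mul, star_star, hsr, mul_add, mul_sub, add_mul, sub_mul, mul_smul_comm,
      smul_mul_assoc, mul_one, mul_assoc]
    abel
  rw [← map_sub, key, map_sub, map_smul, map_smul, smul_eq_mul, smul_eq_mul]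
  nlinarith [hb (star e * r ^ k)]

/-- An idempotent of trace zero vanishes. -/
theorem eq_zero_of_isIdempotentElem (hτ : IsBoundedFaithfulTrace τ) {e : A}
    (he : IsIdempotentElem e) (h0 : τ e = 0) : e = 0 := by
  obtain ⟨ε, hε, hb⟩ := hτ.exists_pos_smul_bound e
  have step := le_map_pow_sub_map_pow hε hb
  set r : A := 1 - ε • (e * star e) with hr
  have hsr (k : ℕ) : star (r ^ k) = r ^ k := by simp [hr]
  set N : ℕ → ℝ := fun k ↦ τ (star (star e * r ^ k) * (star e * r ^ k)) with hN
  set T : ℕ → ℝ := fun k ↦ τ (r ^ (2 * k)) with hT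
  have hN0 (k : ℕ) : 0 ≤ N k := hτ.map_star_mul_self_nonneg _
  have hT0 (k : ℕ) : 0 ≤ T k := by
    have := hτ.map_star_mul_self_nonneg (r ^ k)
    rwa [hsr, ← pow_add, ← two_mul] at this
  have hstep (k : ℕ) : ε * N k ≤ T k - T (k + 1) := step k
  have hanti : Antitone T := antitone_nat_of_succ_le fun k ↦ by
    nlinarith [hstep k, hN0 k]
  have hlimT : Filter.Tendsto T Filter.atTop (nhds (⨅ k, T k)) :=
    tendsto_atTop_ciInf hanti ⟨0, by rintro _ ⟨k, rfl⟩; exact hT0 k⟩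
  have hlimN : Filter.Tendsto N Filter.atTop (nhds 0) := by
    have h := ((hlimT.sub (hlimT.comp (Filter.tendsto_add_atTop_nat 1))).const_mul ε⁻¹)
    rw [sub_self, mul_zero] at h
    refine squeeze_zero hN0 (fun k ↦ ?_) h
    rw [inv_mul_eq_div, le_div_iff₀' hε]
    exact hstep k
  have her (k : ℕ) : e * r ^ k = r ^ k + e - 1 := by
    induction k with
    | zero => simp
    | succ k ih =>
      have h1 : e * r = r + e - 1 := by
        simp only [hr, mul_sub, mul_one, mul_smul_comm, ← mul_assoc, he.eq]
        abel
      rw [pow_succ, ← mul_assoc, ih, sub_mul, add_mul, h1, one_mul]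
      abel
  have htr (k : ℕ) : τ (star e * r ^ k) = τ (r ^ k) - τ 1 := by
    rw [← hτ.map_star, star_mul, star_star, hsr, hτ.map_mul_comm, her, map_sub, map_add, h0,
      add_zero]
  have hexp (s : ℝ) (k : ℕ) : 0 ≤ N k + 2 * s * (τ (r ^ k) - τ 1) + s ^ 2 * τ 1 := by
    have h := hτ.map_star_mul_self_nonneg (star e * r ^ k + s • (1 : A))
    have hs : τ (star (star e * r ^ k)) = τ (star e * r ^ k) := hτ.map_star _
    simp only [star_add, star_smul, star_one, add_mul, mul_add, map_add, smul_mul_assoc,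
      mul_smul_comm, map_smul, one_mul, mul_one, hs, htr, smul_eq_mul, star_trivial] at h
    linarith
  have hT1 (k : ℕ) : T (k + 1) - τ 1 ≤ -(ε * N 0) := by
    have h1 := hanti (Nat.le_add_left 1 k)
    have h2 := hstep 0
    have h3 : T 0 = τ 1 := by simp [hT]
    simp only [zero_add] at h2
    linarith
  have hbound (s : ℝ) (hs : 0 ≤ s) : 2 * s * (ε * N 0) ≤ s ^ 2 * τ 1 := by
    have hlim : Filter.Tendsto (fun k : ℕ ↦ N (2 * (k + 1)) + s ^ 2 * τ 1) Filter.atTop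
        (nhds (0 + s ^ 2 * τ 1)) :=
      (hlimN.comp (Filter.tendsto_atTop_mono (fun k ↦ by simp only [id]; omega)
        Filter.tendsto_id)).add_const _
    rw [zero_add] at hlim
    refine ge_of_tendsto' hlim fun k ↦ ?_
    have h1 := hexp s (2 * (k + 1))
    have h2 : τ (r ^ (2 * (k + 1))) - τ 1 ≤ -(ε * N 0) := hT1 k
    nlinarith
  have h1 : 0 ≤ τ 1 := by simpa [hT] using hT0 0
  have hN00 : N 0 = 0 := by
    by_contra hne
    have hpos : 0 < ε * N 0 := mul_pos hε ((hN0 0).lt_of_ne' hne)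
    have h2 := hbound (ε * N 0 / (τ 1 + 1)) (by positivity)
    have h3 : (ε * N 0 / (τ 1 + 1)) * (τ 1 + 1) = ε * N 0 := by field_simp
    have h4 : 0 < ε * N 0 / (τ 1 + 1) := by positivity
    nlinarith
  have := hτ.eq_zero_of_map_star_mul_self (star e) (by simpa [hN] using hN00)
  simpa using this

theorem isDedekindFiniteMonoid (hτ : IsBoundedFaithfulTrace τ) : IsDedekindFiniteMonoid A where
  mul_eq_one_symm {x y} h := by
    have hi : IsIdempotentElem (1 - y * x) := by
      refine IsIdempotentElem.one_sub ?_
      rw [IsIdempotentElem, mul_assoc, ← mul_assoc x, h, one_mul]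
    have h0 : τ (1 - y * x) = 0 := by rw [map_sub, hτ.map_mul_comm, h, sub_self]
    exact (sub_eq_zero.1 (hτ.eq_zero_of_isIdempotentElem hi h0)).symm

end IsBoundedFaithfulTrace

namespace Matrix

variable {A ι : Type*} [Ring A] [StarRing A] [Algebra ℝ A] [Fintype ι] {τ : A →ₗ[ℝ] ℝ}

theorem map_trace_star_mul_self (τ : A →ₗ[ℝ] ℝ) (M : Matrix ι ι A) :
    τ (trace (star M * M)) = ∑ i, ∑ j, τ (star (M j i) * M j i) := by
  simp [trace, mul_apply, star_apply]

theorem _root_.IsBoundedFaithfulTrace.comp_trace [DecidableEq ι]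
    (hτ : IsBoundedFaithfulTrace τ) :
    IsBoundedFaithfulTrace (τ ∘ₗ traceLinearMap ι ℝ A) := by
  have hnonneg (M : Matrix ι ι A) : 0 ≤ τ (trace (star M * M)) := by
    rw [map_trace_star_mul_self]
    exact Finset.sum_nonneg fun i _ ↦ Finset.sum_nonneg fun j _ ↦ hτ.map_star_mul_self_nonneg _
  refine ⟨fun M N ↦ ?_, fun M ↦ ?_, hnonneg, fun M hM ↦ ?_, fun M ↦ ?_⟩
  · simp only [LinearMap.comp_apply, traceLinearMap_apply, trace, diag, mul_apply, map_sum]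
    rw [Finset.sum_comm]
    simp only [hτ.map_mul_comm]
  · simp [trace, star_apply, hτ.map_star]
  · simp only [LinearMap.comp_apply, traceLinearMap_apply, map_trace_star_mul_self] at hM
    ext j i
    have h1 := (Finset.sum_eq_zero_iff_of_nonneg fun i _ ↦ Finset.sum_nonneg fun j _ ↦
      hτ.map_star_mul_self_nonneg _).1 hM i (Finset.mem_univ i)
    have h2 := (Finset.sum_eq_zero_iff_of_nonneg fun j _ ↦
      hτ.map_star_mul_self_nonneg _).1 h1 j (Finset.mem_univ j)
    exact hτ.eq_zero_of_map_star_mul_self _ h2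
  · induction M using Matrix.induction_on' with
    | h_zero => exact ⟨0, fun x ↦ by simp⟩
    | h_add M N hM hN => exact IsBoundedFaithfulTrace.exists_bound_add hnonneg hM hN
    | h_std_basis i j a =>
      obtain ⟨C, hC⟩ := hτ.exists_bound a
      refine ⟨|C|, fun x ↦ ?_⟩
      simp only [LinearMap.comp_apply, traceLinearMap_apply, map_trace_star_mul_self,
        Finset.mul_sum]
      refine Finset.sum_le_sum fun l _ ↦ ?_
      rw [Finset.sum_eq_single i (fun k _ hk ↦ by simp [single_mul_apply_of_ne _ _ _ _ _ hk])
        (by simp), single_mul_apply_same]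
      refine (hC _).trans <| (mul_le_mul_of_nonneg_right (le_abs_self C)
        (hτ.map_star_mul_self_nonneg _)).trans ?_
      exact Finset.single_le_sum (f := fun k ↦ |C| * τ (star (x k l) * x k l))
        (fun k _ ↦ mul_nonneg (abs_nonneg C) (hτ.map_star_mul_self_nonneg _)) (Finset.mem_univ j)

end Matrix

/-- A real `*`-algebra with a bounded faithful trace is stably finite. -/
theorem IsBoundedFaithfulTrace.isStablyFiniteRing {A : Type*} [Ring A] [StarRing A] [Algebra ℝ A]
    [StarModule ℝ A] {τ : A →ₗ[ℝ] ℝ} (hτ : IsBoundedFaithfulTrace τ) : IsStablyFiniteRing A where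
  isDedekindFiniteMonoid _ := hτ.comp_trace.isDedekindFiniteMonoid

namespace MonoidAlgebra

variable {G : Type*} [Group G]

/-- The involution of a real group algebra extending inversion in the group. -/
noncomputable instance : StarRing (MonoidAlgebra ℝ G) where
  star := mapDomain (·⁻¹)
  star_involutive x := by
    induction x using induction_linear with
    | zero => simp
    | add x y hx hy => simp only [mapDomain_add, hx, hy]
    | single g r => simp
  star_mul x y := by
    induction x using induction_linear with
    | zero => simp
    | add x x' hx hx' => simp only [mapDomain_add, add_mul, mul_add, hx, hx']
    | single g r =>
      induction y using induction_linear with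
      | zero => simp
      | add y y' hy hy' => simp only [mapDomain_add, add_mul, mul_add, hy, hy']
      | single h s => simp [single_mul_single, mul_comm]
  star_add := mapDomain_add _

@[simp]
theorem star_single (g : G) (r : ℝ) : star (single g r) = single g⁻¹ r := mapDomain_single

theorem coeff_star (x : MonoidAlgebra ℝ G) (g : G) : (star x).coeff g = x.coeff g⁻¹ := by
  classical
  induction x using induction_linear with
  | zero => simp
  | add x y hx hy => simp [hx, hy]
  | single h r => simp [Finsupp.single_apply, inv_eq_iff_eq_inv]

instance : StarModule ℝ (MonoidAlgebra ℝ G) where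
  star_smul r x := by ext g; simp [coeff_star]

/-- The coefficient of the identity, as a linear form on a real group algebra. -/
noncomputable def coeffOne (G : Type*) [Group G] : MonoidAlgebra ℝ G →ₗ[ℝ] ℝ where
  toFun x := x.coeff 1
  map_add' _ _ := rfl
  map_smul' _ _ := rfl

@[simp]
theorem coeffOne_apply (x : MonoidAlgebra ℝ G) : coeffOne G x = x.coeff 1 := rfl

theorem coeff_star_mul_self_one (x : MonoidAlgebra ℝ G) :
    (star x * x).coeff 1 = ∑ g ∈ x.coeff.support, x.coeff g ^ 2 := by
  rw [coeff_mul_apply_right, Finsupp.sum]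
  simp [coeff_star, pow_two]

theorem isBoundedFaithfulTrace_coeffOne : IsBoundedFaithfulTrace (coeffOne G) := by
  have hnonneg (x : MonoidAlgebra ℝ G) : 0 ≤ coeffOne G (star x * x) := by
    rw [coeffOne_apply, coeff_star_mul_self_one]
    positivity
  refine ⟨fun x y ↦ ?_, fun x ↦ by simp [coeff_star], hnonneg, fun x hx ↦ ?_, fun a ↦ ?_⟩
  · rw [coeffOne_apply, coeffOne_apply, coeff_mul_apply_left, coeff_mul_apply_right]
    simp [mul_comm]
  · rw [coeffOne_apply, coeff_star_mul_self_one,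
      Finset.sum_eq_zero_iff_of_nonneg fun _ _ ↦ sq_nonneg _] at hx
    ext g
    by_contra hg
    exact hg (pow_eq_zero_iff two_ne_zero |>.1 (hx g (Finsupp.mem_support_iff.2 hg)))
  · induction a using induction_linear with
    | zero => exact ⟨0, fun x ↦ by simp⟩
    | add a b ha hb => exact IsBoundedFaithfulTrace.exists_bound_add hnonneg ha hb
    | single g r =>
      refine ⟨r * r, fun x ↦ le_of_eq ?_⟩
      have h : star (single g r * x) * (single g r * x) = (r * r) • (star x * x) := by
        rw [star_mul, star_single, mul_assoc, ← mul_assoc (single g⁻¹ r), single_mul_single,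
          inv_mul_cancel, ← mul_one (r * r), ← smul_eq_mul (r * r) 1, ← smul_single, ← one_def,
          smul_mul_assoc, one_mul, mul_smul_comm, smul_eq_mul, mul_one]
      rw [h, map_smul, smul_eq_mul]

instance : IsStablyFiniteRing (MonoidAlgebra ℝ G) :=
  isBoundedFaithfulTrace_coeffOne.isStablyFiniteRing

/-- **Kaplansky's theorem**: integral group rings are stably finite. -/
instance : IsStablyFiniteRing (MonoidAlgebra ℤ G) :=
  .of_injective (mapRingHom G (Int.castRingHom ℝ))
    (map_injective (Int.castRingHom ℝ : ℤ →+ ℝ) Int.cast_injective)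

end MonoidAlgebra

/-- If `f` and `g` are `Λ`-linear endomorphisms of the free module `Λⁿ` over the integral
group ring `Λ = ℤ[π]` with `g ∘ f = id`, then `f ∘ g = id`; in particular `f` and `g` are
automorphisms. -/
theorem one_sided_inverse_endomorphism_free_module
    (π : Type*) [Group π] (n : ℕ)
    (f g : (Fin n → MonoidAlgebra ℤ π) →ₗ[MonoidAlgebra ℤ π] (Fin n → MonoidAlgebra ℤ π))
    (h : g.comp f = LinearMap.id) :
    f.comp g = LinearMap.id ∧ Function.Bijective f ∧ Function.Bijective g := by
  have hfg : f.comp g = LinearMap.id := by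
    apply LinearMap.toMatrixRight'.injective
    rw [LinearMap.toMatrixRight'_comp, LinearMap.toMatrixRight'_id]
    apply mul_eq_one_symm
    rw [← LinearMap.toMatrixRight'_comp, h, LinearMap.toMatrixRight'_id]
  have hl : Function.LeftInverse g f := LinearMap.congr_fun h
  have hr : Function.LeftInverse f g := LinearMap.congr_fun hfg
  exact ⟨hfg, ⟨hl.injective, hr.surjective⟩, ⟨hr.injective, hl.surjective⟩⟩
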